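/- Let (Ω, 𝓕, P) be a probability space, a ∈ ℝ, and let X : [0,∞) → Ω → ℝ be a process such that: each X_t is measurable; X_0 = 0 almost surely; almost surely the path t ↦ X_t(ω) is continuous; X has independent increments (for every finite sequence 0 ≤ t_0 ≤ t_1 ≤ ⋯ ≤ t_n, the random variables X_{t_1} − X_{t_0}, …, X_{t_n} − X_{t_{n−1}} are jointly independent); and for every ε > 0 there exists δ_0 > 0 such that for all t ≥ 0 and all δ ∈ (0, δ_0), exp(−(a+ε)) ≤ E[exp(−(X_{t+δ} − X_t)/δ)] ≤ exp(−(a−ε)). Then almost surely X_t = a·t for all t ≥ 0. -/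

import Mathlib

open MeasureTheory ProbabilityTheory

/-- The `i`-th point of the uniform partition of `[s, s + L]` into `n` pieces. -/
noncomputable def gridPoint (s L : ℝ) (n i : ℕ) : ℝ := s + L * i / n

/-- The increment of `X` over the `i`-th piece of the uniform partition of `[s, s + L]`. -/
noncomputable def gridIncrement {Ω : Type*} (X : ℝ → Ω → ℝ) (s L : ℝ) (n i : ℕ) (ω : Ω) : ℝ :=
  X (gridPoint s L n (i + 1)) ω - X (gridPoint s L n i) ω

lemma gridPoint_zero (s L : ℝ) (n : ℕ) : gridPoint s L n 0 = s := by
  simp [gridPoint]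

lemma gridPoint_self (s L : ℝ) {n : ℕ} (hn : n ≠ 0) : gridPoint s L n n = s + L := by
  have : (n : ℝ) ≠ 0 := by exact_mod_cast hn
  simp [gridPoint, this]

lemma gridPoint_succ (s L : ℝ) (n i : ℕ) :
    gridPoint s L n (i + 1) = gridPoint s L n i + L / n := by
  simp only [gridPoint]
  push_cast
  ring

lemma gridPoint_mono (s : ℝ) {L : ℝ} (hL : 0 ≤ L) (n : ℕ) : Monotone (gridPoint s L n) := by
  intro i j hij
  simp only [gridPoint]
  gcongr

lemma le_gridPoint (s : ℝ) {L : ℝ} (hL : 0 ≤ L) (n i : ℕ) : s ≤ gridPoint s L n i := by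
  simpa [gridPoint_zero] using gridPoint_mono s hL n (Nat.zero_le i)

lemma sum_gridIncrement {Ω : Type*} (X : ℝ → Ω → ℝ) (s L : ℝ) {n : ℕ} (hn : n ≠ 0) (ω : Ω) :
    ∑ i : Fin n, gridIncrement X s L n i ω = X (s + L) ω - X s ω := by
  rw [Fin.sum_univ_eq_sum_range (fun i => gridIncrement X s L n i ω)]
  simp only [gridIncrement]
  rw [Finset.sum_range_sub (fun i => X (gridPoint s L n i) ω), gridPoint_zero,
    gridPoint_self s L hn]

lemma measurable_gridIncrement {Ω : Type*} [MeasurableSpace Ω] {X : ℝ → Ω → ℝ}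
    (hmeas : ∀ t : ℝ, Measurable (X t)) (s L : ℝ) (n i : ℕ) :
    Measurable (gridIncrement X s L n i) :=
  (hmeas _).sub (hmeas _)

lemma iIndepFun_gridIncrement {Ω : Type*} [MeasurableSpace Ω] {P : Measure Ω} {X : ℝ → Ω → ℝ}
    (hindep : ∀ n : ℕ, ∀ t : Fin (n + 1) → ℝ, (∀ i, 0 ≤ t i) → Monotone t →
      iIndepFun
        (fun i : Fin n => fun ω => X (t i.succ) ω - X (t i.castSucc) ω) P)
    {s L : ℝ} (hs : 0 ≤ s) (hL : 0 ≤ L) (n : ℕ) :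
    iIndepFun (fun i : Fin n => gridIncrement X s L n i) P :=
  hindep n (fun i => gridPoint s L n i) (fun i => hs.trans (le_gridPoint s hL n i))
    fun _ _ hij => gridPoint_mono s hL n hij

/-- Along a path that is continuous on `[s, s + L]`, the increments over fine uniform partitions
are uniformly small. -/
lemma eventually_abs_gridIncrement_le {Ω : Type*} {X : ℝ → Ω → ℝ} {ω : Ω} {s L η : ℝ}
    (hL : 0 ≤ L) (hη : 0 < η)
    (hcont : ContinuousOn (fun t => X t ω) (Set.Icc s (s + L))) :
    ∀ᶠ n : ℕ in Filter.atTop, ∀ i : Fin n, |gridIncrement X s L n i ω| ≤ η := by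
  have huc := isCompact_Icc.uniformContinuousOn_of_continuous hcont
  obtain ⟨δ, hδ, h⟩ := Metric.uniformContinuousOn_iff.1 huc η hη
  filter_upwards [(tendsto_const_div_atTop_nhds_zero_nat L).eventually_lt_const hδ,
    Filter.eventually_ne_atTop 0] with n hn hn0 i
  have hmem : ∀ j : ℕ, j ≤ n → gridPoint s L n j ∈ Set.Icc s (s + L) := fun j hj =>
    ⟨le_gridPoint s hL n j, (gridPoint_mono s hL n hj).trans_eq (gridPoint_self s L hn0)⟩
  refine (h _ (hmem _ i.2) _ (hmem _ i.2.le) ?_).le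
  rw [gridPoint_succ, Real.dist_eq, add_sub_cancel_left, abs_of_nonneg (by positivity)]
  exact hn

/-- Independence turns the bounds for small time steps into bounds for the Laplace transform
of a fixed increment at large parameters. -/
lemma eventually_mgf_increment_bounds {Ω : Type*} [MeasurableSpace Ω] {P : Measure Ω}
    {X : ℝ → Ω → ℝ} {a : ℝ}
    (hmeas : ∀ t : ℝ, Measurable (X t))
    (hindep : ∀ n : ℕ, ∀ t : Fin (n + 1) → ℝ, (∀ i, 0 ≤ t i) → Monotone t →
      iIndepFun
        (fun i : Fin n => fun ω => X (t i.succ) ω - X (t i.castSucc) ω) P)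
    (hLap : ∀ ε : ℝ, 0 < ε → ∃ δ₀ : ℝ, 0 < δ₀ ∧ ∀ t δ : ℝ, 0 ≤ t → 0 < δ → δ < δ₀ →
      Real.exp (-(a + ε)) ≤ ∫ ω, Real.exp (-((X (t + δ) ω - X t ω) / δ)) ∂P ∧
      ∫ ω, Real.exp (-((X (t + δ) ω - X t ω) / δ)) ∂P ≤ Real.exp (-(a - ε)))
    {s L : ℝ} (hs : 0 ≤ s) (hL : 0 < L) {ε : ℝ} (hε : 0 < ε) :
    ∀ᶠ n : ℕ in Filter.atTop,
      Real.exp (-(a + ε)) ^ n ≤ mgf (fun ω => (X (s + L) ω - X s ω) / L) P (-(n : ℝ)) ∧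
      mgf (fun ω => (X (s + L) ω - X s ω) / L) P (-(n : ℝ)) ≤ Real.exp (-(a - ε)) ^ n := by
  obtain ⟨δ₀, hδ₀, hb⟩ := hLap ε hε
  filter_upwards [(tendsto_const_div_atTop_nhds_zero_nat L).eventually_lt_const hδ₀,
    Filter.eventually_ne_atTop 0] with n hn hn0
  have hnpos : (0 : ℝ) < n := by exact_mod_cast Nat.pos_of_ne_zero hn0
  have hprod : mgf (fun ω => (X (s + L) ω - X s ω) / L) P (-(n : ℝ)) =
      ∏ i : Fin n, mgf (gridIncrement X s L n i) P (-(n / L)) := by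
    rw [← (iIndepFun_gridIncrement hindep hs hL.le n).mgf_sum
      (fun i => measurable_gridIncrement hmeas s L n i)]
    refine integral_congr_ae (ae_of_all _ fun ω => ?_)
    simp only [Finset.sum_apply, sum_gridIncrement X s L hn0 ω]
    congr 1
    ring
  have hstep : ∀ i : Fin n, Real.exp (-(a + ε)) ≤ mgf (gridIncrement X s L n i) P (-(n / L)) ∧
      mgf (gridIncrement X s L n i) P (-(n / L)) ≤ Real.exp (-(a - ε)) := by
    intro i
    have h := hb (gridPoint s L n i) (L / n) (hs.trans (le_gridPoint s hL.le n i))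
      (by positivity) hn
    have heq : mgf (gridIncrement X s L n i) P (-(n / L)) =
        ∫ ω, Real.exp (-((X (gridPoint s L n i + L / n) ω - X (gridPoint s L n i) ω)
          / (L / n))) ∂P := by
      refine integral_congr_ae (ae_of_all _ fun ω => ?_)
      simp only [gridIncrement, gridPoint_succ]
      congr 1
      field_simp
    rwa [heq]
  rw [hprod]
  constructor
  · calc Real.exp (-(a + ε)) ^ n = ∏ _i : Fin n, Real.exp (-(a + ε)) := by simp
      _ ≤ _ := Finset.prod_le_prod (fun i _ => (Real.exp_pos _).le) fun i _ => (hstep i).1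
  · calc _ ≤ ∏ _i : Fin n, Real.exp (-(a - ε)) :=
          Finset.prod_le_prod (fun i _ => mgf_nonneg) fun i _ => (hstep i).2
      _ = _ := by simp

lemma Real.exp_neg_le_one_sub_half {x : ℝ} (h0 : 0 ≤ x) (h1 : x ≤ 1) :
    Real.exp (-x) ≤ 1 - x / 2 := by
  have h := Real.add_one_le_exp x
  rw [Real.exp_neg, inv_le_iff_one_le_mul₀ (Real.exp_pos x)]
  nlinarith

section Laplace

variable {Ω : Type*} [MeasurableSpace Ω] {P : Measure Ω} [IsProbabilityMeasure P]

/-- For a small nonnegative random variable, the Laplace exponent grows at least linearly,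
up to a factor `1 / 2`. -/
lemma mgf_neg_le_rpow_mgf_neg_one {V : Ω → ℝ} (hV : Measurable V) {l η : ℝ} (hl : 0 ≤ l)
    (hlη : l * η ≤ 1) (h0 : ∀ ω, 0 ≤ V ω) (h1 : ∀ ω, V ω ≤ η) :
    mgf V P (-l) ≤ (mgf V P (-1)) ^ (l / 2) := by
  have hint : Integrable V P :=
    Integrable.of_bound hV.aestronglyMeasurable η
      (ae_of_all _ fun ω => by rw [Real.norm_of_nonneg (h0 ω)]; exact h1 ω)
  have hexp : ∀ c : ℝ, 0 ≤ c → Integrable (fun ω => Real.exp (-c * V ω)) P := fun c hc =>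
    Integrable.of_bound (by fun_prop) 1 (ae_of_all _ fun ω => by
      rw [Real.norm_of_nonneg (Real.exp_pos _).le, Real.exp_le_one_iff]
      nlinarith [mul_nonneg hc (h0 ω)])
  set m := ∫ ω, V ω ∂P with hm
  have hupper : mgf V P (-l) ≤ Real.exp (-m * (l / 2)) := by
    calc mgf V P (-l) ≤ ∫ ω, (1 - l / 2 * V ω) ∂P := by
          refine integral_mono (hexp l hl) ((integrable_const _).sub (hint.const_mul _)) ?_
          intro ω
          have := Real.exp_neg_le_one_sub_half (mul_nonneg hl (h0 ω))
            ((mul_le_mul_of_nonneg_left (h1 ω) hl).trans hlη)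
          simp only [neg_mul]
          linarith
      _ = 1 - l / 2 * m := by
          rw [integral_sub (integrable_const _) (hint.const_mul _), integral_const_mul]
          simp [hm]
      _ ≤ Real.exp (-m * (l / 2)) := by
          have := Real.add_one_le_exp (-m * (l / 2))
          linarith
  have hlower : Real.exp (-m) ≤ mgf V P (-1) := by
    calc Real.exp (-m) = ∫ ω, Real.exp (-m) * (1 + m - V ω) ∂P := by
          rw [integral_const_mul, integral_sub (integrable_const _) hint]
          simp [hm]
      _ ≤ mgf V P (-1) := by
          refine integral_mono (((integrable_const _).sub hint).const_mul _)
            (hexp 1 zero_le_one) ?_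
          intro ω
          have h : -1 * V ω = -m + (m - V ω) := by ring
          simp only [h, Real.exp_add]
          have := Real.add_one_le_exp (m - V ω)
          gcongr
          linarith
  calc mgf V P (-l) ≤ Real.exp (-m * (l / 2)) := hupper
    _ = Real.exp (-m) ^ (l / 2) := Real.exp_mul _ _
    _ ≤ _ := Real.rpow_le_rpow (Real.exp_pos _).le hlower (by positivity)

lemma mgf_sum_neg_le_rpow_mgf_sum_neg_one {n : ℕ} {V : Fin n → Ω → ℝ}
    (hV : ∀ i, Measurable (V i)) (hindep : iIndepFun V P) {l η : ℝ} (hl : 0 ≤ l)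
    (hlη : l * η ≤ 1) (h0 : ∀ i ω, 0 ≤ V i ω) (h1 : ∀ i ω, V i ω ≤ η) :
    mgf (∑ i, V i) P (-l) ≤ (mgf (∑ i, V i) P (-1)) ^ (l / 2) := by
  rw [hindep.mgf_sum hV, hindep.mgf_sum hV,
    ← Real.finsetProd_rpow _ _ fun i _ => mgf_nonneg]
  exact Finset.prod_le_prod (fun i _ => mgf_nonneg)
    fun i _ => mgf_neg_le_rpow_mgf_neg_one (hV i) hl hlη (h0 i) (h1 i)

/-- If the Laplace transforms of `Y` at large integers `n` are at most `exp (-(a - ε)) ^ n`,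
for each `ε > 0`, then `Y ≥ a` almost surely. -/
lemma ae_le_of_mgf_neg_le {Y : Ω → ℝ} {a : ℝ}
    (hint : ∀ᶠ n : ℕ in Filter.atTop, Integrable (fun ω => Real.exp (-(n : ℝ) * Y ω)) P)
    (h : ∀ ε : ℝ, 0 < ε → ∀ᶠ n : ℕ in Filter.atTop,
      mgf Y P (-(n : ℝ)) ≤ Real.exp (-(a - ε)) ^ n) :
    ∀ᵐ ω ∂P, a ≤ Y ω := by
  have key : ∀ ε : ℝ, 0 < ε → ∀ᵐ ω ∂P, a - 2 * ε < Y ω := by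
    intro ε hε
    have hbound : ∀ᶠ n : ℕ in Filter.atTop,
        P.real {ω | Y ω ≤ a - 2 * ε} ≤ Real.exp (-ε) ^ n := by
      filter_upwards [hint, h ε hε] with n hn hle
      calc P.real {ω | Y ω ≤ a - 2 * ε}
          ≤ Real.exp (-(-(n : ℝ)) * (a - 2 * ε)) * mgf Y P (-(n : ℝ)) :=
            measure_le_le_exp_mul_mgf _ (by simp) hn
        _ ≤ Real.exp (-(-(n : ℝ)) * (a - 2 * ε)) * Real.exp (-(a - ε)) ^ n := by gcongr
        _ = Real.exp (-ε) ^ n := by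
            rw [← Real.exp_nat_mul, ← Real.exp_nat_mul, ← Real.exp_add]
            congr 1
            ring
    have hlim : Filter.Tendsto (fun n : ℕ => Real.exp (-ε) ^ n) Filter.atTop (nhds 0) :=
      tendsto_pow_atTop_nhds_zero_of_lt_one (Real.exp_pos _).le (by simpa using hε)
    have hzero : P.real {ω | Y ω ≤ a - 2 * ε} = 0 :=
      le_antisymm (ge_of_tendsto hlim hbound) measureReal_nonneg
    rw [measureReal_eq_zero_iff] at hzero
    simpa [ae_iff] using hzero
  have hall : ∀ᵐ ω ∂P, ∀ k : ℕ, a - 2 * (1 / ((k : ℝ) + 1)) < Y ω :=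
    ae_all_iff.2 fun k => key _ (by positivity)
  filter_upwards [hall] with ω hω
  have hlim := (tendsto_one_div_add_atTop_nhds_zero_nat (𝕜 := ℝ)).const_mul 2 |>.const_sub a
  simp only [mul_zero, sub_zero] at hlim
  exact le_of_tendsto' hlim fun k => (hω k).le

/-- The increment of a continuous nondecreasing process with independent increments has a Laplace
exponent that grows at least linearly, up to a factor `1 / 2`. -/
lemma mgf_increment_neg_le_rpow {X : ℝ → Ω → ℝ}
    (hmeas : ∀ t : ℝ, Measurable (X t))
    (hcont : ∀ᵐ ω ∂P, ContinuousOn (fun t => X t ω) (Set.Ici (0 : ℝ)))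
    (hindep : ∀ n : ℕ, ∀ t : Fin (n + 1) → ℝ, (∀ i, 0 ≤ t i) → Monotone t →
      iIndepFun
        (fun i : Fin n => fun ω => X (t i.succ) ω - X (t i.castSucc) ω) P)
    (hmono : ∀ s t : ℝ, 0 ≤ s → s ≤ t → ∀ᵐ ω ∂P, X s ω ≤ X t ω)
    {s L l : ℝ} (hs : 0 ≤ s) (hL : 0 ≤ L) (hl : 0 < l) :
    mgf (fun ω => X (s + L) ω - X s ω) P (-l) ≤
      (mgf (fun ω => X (s + L) ω - X s ω) P (-1)) ^ (l / 2) := by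
  set f : ℝ → ℝ := fun x => max 0 (min (1 / l) x) with hf
  have hfm : Measurable f := by fun_prop
  have hf0 : ∀ x, 0 ≤ f x := fun x => le_max_left _ _
  have hf1 : ∀ x, f x ≤ 1 / l := fun x => max_le (by positivity) (min_le_left _ _)
  set V : (n : ℕ) → Fin n → Ω → ℝ := fun n i ω => f (gridIncrement X s L n i ω) with hVdef
  have hVm : ∀ n i, Measurable (V n i) := fun n i =>
    hfm.comp (measurable_gridIncrement hmeas s L n i)
  have hle : ∀ n, mgf (∑ i, V n i) P (-l) ≤ (mgf (∑ i, V n i) P (-1)) ^ (l / 2) := fun n =>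
    mgf_sum_neg_le_rpow_mgf_sum_neg_one (hVm n)
      ((iIndepFun_gridIncrement hindep hs hL n).comp (fun _ => f) fun _ => hfm)
      hl.le (by rw [mul_one_div_cancel hl.ne']) (fun i ω => hf0 _) fun i ω => hf1 _
  have hincr : ∀ᵐ ω ∂P, ∀ n i : ℕ, 0 ≤ gridIncrement X s L n i ω := by
    refine ae_all_iff.2 fun n => ae_all_iff.2 fun i => ?_
    filter_upwards [hmono _ _ (hs.trans (le_gridPoint s hL n i))
      (gridPoint_mono s hL n i.le_succ)] with ω hω
    exact sub_nonneg.2 hω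
  have hev : ∀ᵐ ω ∂P, ∀ᶠ n : ℕ in Filter.atTop,
      (∑ i, V n i) ω = X (s + L) ω - X s ω := by
    filter_upwards [hincr, hcont] with ω hω hc
    filter_upwards [eventually_abs_gridIncrement_le hL (one_div_pos.2 hl)
      (hc.mono fun t ht => hs.trans ht.1), Filter.eventually_ne_atTop 0] with n hn hn0
    rw [Finset.sum_apply, ← sum_gridIncrement X s L hn0 ω]
    refine Finset.sum_congr rfl fun i _ => ?_
    simp only [hVdef, hf]
    rw [min_eq_right ((le_abs_self _).trans (hn i)), max_eq_right (hω n i)]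
  have hlim : ∀ c : ℝ, 0 ≤ c → Filter.Tendsto (fun n => mgf (∑ i, V n i) P (-c)) Filter.atTop
      (nhds (mgf (fun ω => X (s + L) ω - X s ω) P (-c))) := by
    intro c hc
    refine tendsto_integral_of_dominated_convergence (fun _ => 1) (fun n => ?_)
      (integrable_const _) (fun n => ae_of_all _ fun ω => ?_) ?_
    · have : Measurable (∑ i, V n i) := by
        simpa only [← Finset.sum_apply] using Finset.measurable_sum Finset.univ fun i _ => hVm n i
      fun_prop
    · rw [Real.norm_of_nonneg (Real.exp_pos _).le, Real.exp_le_one_iff, Finset.sum_apply,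
        neg_mul]
      exact neg_nonpos.2 (mul_nonneg hc (Finset.sum_nonneg fun i _ => hf0 _))
    · filter_upwards [hev] with ω hω
      refine tendsto_const_nhds.congr' ?_
      filter_upwards [hω] with n hn
      rw [hn]
  exact le_of_tendsto_of_tendsto' (hlim l hl.le)
    ((hlim 1 zero_le_one).rpow_const (Or.inr (by positivity))) hle

/-- A nonnegative random variable whose Laplace transform at `1` is at least `1` vanishes. -/
lemma ae_eq_zero_of_one_le_mgf_neg_one {Z : Ω → ℝ} (hZ : Measurable Z)
    (h0 : ∀ᵐ ω ∂P, 0 ≤ Z ω) (h1 : 1 ≤ mgf Z P (-1)) : ∀ᵐ ω ∂P, Z ω = 0 := by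
  have hle : ∀ᵐ ω ∂P, Real.exp (-1 * Z ω) ≤ 1 := by
    filter_upwards [h0] with ω hω
    rw [Real.exp_le_one_iff]
    linarith
  have hint : Integrable (fun ω => Real.exp (-1 * Z ω)) P :=
    Integrable.of_bound (by fun_prop) 1 (by
      filter_upwards [hle] with ω hω
      rwa [Real.norm_of_nonneg (Real.exp_pos _).le])
  have hnn : 0 ≤ᵐ[P] fun ω => 1 - Real.exp (-1 * Z ω) := by
    filter_upwards [hle] with ω hω
    exact sub_nonneg.2 hω
  have hzero : ∫ ω, (1 - Real.exp (-1 * Z ω)) ∂P = 0 := by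
    refine le_antisymm ?_ (integral_nonneg_of_ae hnn)
    rw [integral_sub (integrable_const _) hint]
    simpa [mgf] using h1
  filter_upwards [(integral_eq_zero_iff_of_nonneg_ae hnn ((integrable_const _).sub hint)).1 hzero]
    with ω hω
  have h : Real.exp (-1 * Z ω) = 1 := by
    simp only [Pi.zero_apply] at hω
    linarith
  rw [Real.exp_eq_one_iff] at h
  linarith

end Laplace

/-- A process with independent increments, a.s. continuous paths started at `0`,
whose normalized increments `(X_{t+δ} − X_t)/δ` have Laplace transform at
parameter `1` squeezed between `exp(−(a+ε))` and `exp(−(a−ε))` uniformly in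
`t ≥ 0` for all small `δ > 0`, is almost surely the deterministic linear
function `t ↦ a t` on `[0,∞)`. -/
theorem linear_of_squeezed_laplace_increments
    {Ω : Type*} [MeasurableSpace Ω] (P : Measure Ω) [IsProbabilityMeasure P]
    (a : ℝ) (X : ℝ → Ω → ℝ)
    (hmeas : ∀ t : ℝ, Measurable (X t))
    (h0 : ∀ᵐ ω ∂P, X 0 ω = 0)
    (hcont : ∀ᵐ ω ∂P, ContinuousOn (fun t => X t ω) (Set.Ici (0 : ℝ)))
    (hindep : ∀ n : ℕ, ∀ t : Fin (n + 1) → ℝ, (∀ i, 0 ≤ t i) → Monotone t →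
      iIndepFun
        (fun i : Fin n => fun ω => X (t i.succ) ω - X (t i.castSucc) ω) P)
    (hLap : ∀ ε : ℝ, 0 < ε → ∃ δ₀ : ℝ, 0 < δ₀ ∧ ∀ t δ : ℝ, 0 ≤ t → 0 < δ → δ < δ₀ →
      Real.exp (-(a + ε)) ≤ ∫ ω, Real.exp (-((X (t + δ) ω - X t ω) / δ)) ∂P ∧
      ∫ ω, Real.exp (-((X (t + δ) ω - X t ω) / δ)) ∂P ≤ Real.exp (-(a - ε))) :
    ∀ᵐ ω ∂P, ∀ t : ℝ, 0 ≤ t → X t ω = a * t := by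
  have hbd : ∀ s L ε : ℝ, 0 ≤ s → 0 < L → 0 < ε → _ := fun s L ε hs hL hε =>
    eventually_mgf_increment_bounds hmeas hindep hLap hs hL hε
  have hge : ∀ s L : ℝ, 0 ≤ s → 0 < L → ∀ᵐ ω ∂P, a ≤ (X (s + L) ω - X s ω) / L := by
    intro s L hs hL
    refine ae_le_of_mgf_neg_le ?_ fun ε hε => (hbd s L ε hs hL hε).mono fun n hn => hn.2
    filter_upwards [hbd s L 1 hs hL one_pos] with n hn
    by_contra hni
    have := (pow_pos (Real.exp_pos _) n).trans_le hn.1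
    rw [mgf_undef hni] at this
    exact lt_irrefl _ this
  set Z : ℝ → Ω → ℝ := fun t ω => X t ω - a * t with hZ
  have hZmeas : ∀ t, Measurable (Z t) := fun t => (hmeas t).sub_const _
  have hZmono : ∀ s t : ℝ, 0 ≤ s → s ≤ t → ∀ᵐ ω ∂P, Z s ω ≤ Z t ω := by
    intro s t hs hst
    rcases hst.eq_or_lt with rfl | hlt
    · exact ae_of_all _ fun _ => le_rfl
    · filter_upwards [hge s (t - s) hs (sub_pos.2 hlt)] with ω hω
      rw [le_div_iff₀ (sub_pos.2 hlt), add_sub_cancel] at hω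
      simp only [hZ]
      linarith
  have hZcont : ∀ᵐ ω ∂P, ContinuousOn (fun t => Z t ω) (Set.Ici (0 : ℝ)) := by
    filter_upwards [hcont] with ω hω
    exact hω.sub (by fun_prop)
  have hZindep : ∀ n : ℕ, ∀ t : Fin (n + 1) → ℝ, (∀ i, 0 ≤ t i) → Monotone t →
      iIndepFun (fun i : Fin n => fun ω => Z (t i.succ) ω - Z (t i.castSucc) ω) P := by
    intro n t ht htm
    convert (hindep n t ht htm).comp (fun i x => x - a * (t i.succ - t i.castSucc))
      (fun i => by fun_prop) using 3 with i ω
    simp only [hZ, Function.comp]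
    ring
  have hone : ∀ t : ℝ, 0 < t → 1 ≤ mgf (fun ω => Z (0 + t) ω - Z 0 ω) P (-1) := by
    intro t ht
    set M := mgf (fun ω => Z (0 + t) ω - Z 0 ω) P (-1) with hM
    have hMε : ∀ ε : ℝ, 0 < ε → Real.exp (-(2 * t * ε)) ≤ M := by
      intro ε hε
      obtain ⟨n, hn, hnpos⟩ :=
        ((hbd 0 t ε le_rfl ht hε).and (Filter.eventually_gt_atTop 0)).exists
      have hnR : (0 : ℝ) < n := by exact_mod_cast hnpos
      have hshift : mgf (fun ω => Z (0 + t) ω - Z 0 ω) P (-(n / t)) =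
          Real.exp (n * a) * mgf (fun ω => (X (0 + t) ω - X 0 ω) / t) P (-(n : ℝ)) := by
        simp only [mgf]
        rw [← integral_const_mul]
        refine integral_congr_ae (ae_of_all _ fun ω => ?_)
        simp only [hZ, ← Real.exp_add]
        congr 1
        field_simp
        ring
      have hlow : Real.exp (-(2 * t * ε)) ^ (n / t / 2 : ℝ) ≤ M ^ (n / t / 2 : ℝ) := by
        calc Real.exp (-(2 * t * ε)) ^ (n / t / 2 : ℝ)
            = Real.exp (n * a) * Real.exp (-(a + ε)) ^ n := by
              rw [← Real.exp_mul, ← Real.exp_nat_mul, ← Real.exp_add]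
              congr 1
              field_simp
              ring
          _ ≤ mgf (fun ω => Z (0 + t) ω - Z 0 ω) P (-(n / t)) := by
              rw [hshift]
              exact mul_le_mul_of_nonneg_left hn.1 (Real.exp_pos _).le
          _ ≤ _ := mgf_increment_neg_le_rpow hZmeas hZcont hZindep hZmono le_rfl ht.le
              (by positivity)
      exact (Real.rpow_le_rpow_iff (Real.exp_pos _).le mgf_nonneg (by positivity)).1 hlow
    have hlim : Filter.Tendsto (fun ε : ℝ => Real.exp (-(2 * t * ε)))
        (nhdsWithin 0 (Set.Ioi 0)) (nhds 1) := by
      have : Continuous fun ε : ℝ => Real.exp (-(2 * t * ε)) := by fun_prop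
      simpa using (this.tendsto 0).mono_left nhdsWithin_le_nhds
    exact le_of_tendsto hlim (eventually_nhdsWithin_of_forall hMε)
  have hpt : ∀ t : ℝ, 0 ≤ t → ∀ᵐ ω ∂P, X t ω = a * t := by
    intro t ht
    rcases ht.eq_or_lt with rfl | hpos
    · simpa using h0
    · have hnn : ∀ᵐ ω ∂P, 0 ≤ Z (0 + t) ω - Z 0 ω := by
        filter_upwards [hZmono 0 (0 + t) le_rfl (by linarith)] with ω hω
        exact sub_nonneg.2 hω
      filter_upwards [h0, ae_eq_zero_of_one_le_mgf_neg_one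
        ((hZmeas _).sub (hZmeas _)) hnn (hone t hpos)] with ω hω0 hω
      simp only [hZ, Pi.sub_apply, zero_add, hω0] at hω
      linarith
  have hrat : ∀ᵐ ω ∂P, ∀ q : ℚ, X |(q : ℝ)| ω = a * |(q : ℝ)| :=
    ae_all_iff.2 fun q => hpt _ (abs_nonneg _)
  filter_upwards [hrat, hcont] with ω hω hc t ht
  have hcabs : Continuous fun u : ℝ => X |u| ω :=
    hc.comp_continuous continuous_abs fun u => abs_nonneg u
  have heq : (fun u : ℝ => X |u| ω) = fun u => a * |u| :=
    Rat.denseRange_cast.equalizer hcabs (by fun_prop) (funext hω)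
  simpa [abs_of_nonneg ht] using congrFun heq t
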